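/- Let (R, m) be a one-dimensional Cohen-Macaulay local ring, x ∈ m a minimal reduction of m (a non-zerodivisor with xm^n = m^{n+1} for large n), and I ⊆ J regular m-primary ideals with J Ulrich (μ(J) = e(R)). If my ⊄ xI for every minimal generator y of J, then I is Elias. -/

import Mathlib

open CategoryTheory IsLocalRing

universe u

/-- The length of a module, as the Krull dimension of its submodule lattice. -/
noncomputable def rlength (R : Type u) (M : Type*) [Ring R] [AddCommGroup M]
    [Module R M] : WithBot ℕ∞ :=
  Order.krullDim (Submodule R M)

/-- `dim_k Ext^1_R(k, M)` (measured as `R`-length, which agrees with `k`-dimension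
since the module is killed by the maximal ideal). -/
noncomputable def modType (R : Type u) [CommRing R] [IsLocalRing R]
    (M : ModuleCat.{u} R) : WithBot ℕ∞ :=
  rlength R (((_root_.Ext R (ModuleCat.{u} R) 1).obj
    (Opposite.op (ModuleCat.of R (ResidueField R)))).obj M)

/-- The Cohen–Macaulay type of an `m`-primary ideal `I`:  `dim_k Ext^1_R(k, I)`. -/
noncomputable def idealType (R : Type u) [CommRing R] [IsLocalRing R] (I : Ideal R) :
    WithBot ℕ∞ :=
  modType R (ModuleCat.of R I)

/-- The Cohen–Macaulay type of `R/I`: `dim_k Hom_R(k, R/I)`. -/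
noncomputable def quotType (R : Type u) [CommRing R] [IsLocalRing R] (I : Ideal R) :
    WithBot ℕ∞ :=
  rlength R (ResidueField R →ₗ[R] R ⧸ I)

/-- An ideal is `m`-primary iff its radical is the maximal ideal. -/
def IsMPrimary (R : Type u) [CommRing R] [IsLocalRing R] (I : Ideal R) : Prop :=
  I.radical = maximalIdeal R

/-- `I` is Elias if `type(I) = type(R/I)`. -/
def EliasIdeal (R : Type u) [CommRing R] [IsLocalRing R] (I : Ideal R) : Prop :=
  idealType R I = quotType R I

/-- The minimal number of generators, as `dim_k I/mI`. -/
noncomputable def mu (R : Type u) [CommRing R] [IsLocalRing R] (I : Ideal R) :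
    WithBot ℕ∞ :=
  rlength R (I ⧸ (maximalIdeal R • ⊤ : Submodule R I))

/-- `R` has Hilbert–Samuel multiplicity `e`. -/
def HasMultiplicity (R : Type u) [CommRing R] [IsLocalRing R] (e : ℕ) : Prop :=
  ∃ N : ℕ, ∀ n ≥ N,
    rlength R (R ⧸ (maximalIdeal R) ^ (n + 1)) =
      rlength R (R ⧸ (maximalIdeal R) ^ n) + (e : WithBot ℕ∞)

lemma rlength_eq_coe_length (R : Type u) (M : Type*) [Ring R] [AddCommGroup M] [Module R M] :
    rlength R M = (Module.length R M : WithBot ℕ∞) :=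
  (Module.coe_length R M).symm

lemma rlength_eq_of_linearEquiv {R : Type u} {M N : Type*} [Ring R] [AddCommGroup M] [Module R M]
    [AddCommGroup N] [Module R N] (e : M ≃ₗ[R] N) : rlength R M = rlength R N := by
  rw [rlength_eq_coe_length, rlength_eq_coe_length, e.length_eq]

section Length

variable {R : Type u} [CommRing R]

open scoped Pointwise in
lemma length_quotient_span_mul {x : R} (hx : x ∈ nonZeroDivisors R) (B : Ideal R) :
    Module.length R (R ⧸ Ideal.span {x} * B) =
      Module.length R (R ⧸ B) + Module.length R (R ⧸ Ideal.span {x}) := by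
  have h := Module.length_eq_add_of_exact (Ideal.mulQuot x B) (Ideal.quotOfMul x B)
    (Ideal.mulQuot_injective B hx) (Ideal.quotOfMul_surjective B) (Ideal.exact_mulQuot_quotOfMul B)
  have hB : x • B = Ideal.span {x} * B := by
    rw [← Submodule.ideal_span_singleton_smul, smul_eq_mul]
  rwa [hB] at h

lemma length_quotient_mul (A B : Ideal R) :
    Module.length R (R ⧸ A * B) =
      Module.length R (B ⧸ (A • ⊤ : Submodule R B)) + Module.length R (R ⧸ B) := by
  have hmap : (A • ⊤ : Submodule R B).map B.subtype = A * B := by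
    rw [Submodule.map_smul'', Submodule.map_top, Submodule.range_subtype, smul_eq_mul]
  have hcomap : (A • ⊤ : Submodule R B) = Submodule.comap B.subtype (A * B) := by
    rw [← hmap, Submodule.comap_map_eq_of_injective (Submodule.injective_subtype B)]
  refine Module.length_eq_add_of_exact
    (Submodule.mapQ (A • ⊤ : Submodule R B) (A * B) B.subtype hcomap.le)
    (Submodule.factor Ideal.mul_le_right) ?_ (Submodule.factor_surjective _) ?_
  · rw [← LinearMap.ker_eq_bot, Submodule.ker_mapQ, ← hcomap, Submodule.mkQ_map_self]
  · rw [LinearMap.exact_iff, Submodule.range_mapQ, Submodule.range_subtype]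
    simp [Submodule.factor, Submodule.ker_mapQ]

lemma length_quotient_ne_top_of_mem_nonZeroDivisors [IsNoetherianRing R] [Ring.KrullDimLE 1 R]
    {B : Ideal R} {y : R} (hyB : y ∈ B) (hy : y ∈ nonZeroDivisors R) :
    Module.length R (R ⧸ B) ≠ ⊤ := by
  have h := Module.length_ne_top_iff.mpr (isFiniteLength_quotient_span_singleton R hy)
  have hle : Ideal.span {y} ≤ B := (Ideal.span_singleton_le_iff_mem B).mpr hyB
  exact ne_top_of_le_ne_top h
    (Module.length_le_of_surjective (Submodule.factor hle) (Submodule.factor_surjective hle))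

lemma eq_of_le_of_length_quotient_eq {A B : Ideal R} (hAB : A ≤ B)
    (h : Module.length R (R ⧸ A) = Module.length R (R ⧸ B))
    (hfin : Module.length R (R ⧸ B) ≠ ⊤) : A = B := by
  have hex := Module.length_eq_add_of_exact (LinearMap.ker (Submodule.factor hAB)).subtype
    (Submodule.factor hAB) (Submodule.subtype_injective _) (Submodule.factor_surjective hAB)
    (LinearMap.exact_subtype_ker_map _)
  rw [h] at hex
  have h0 : Module.length R (LinearMap.ker (Submodule.factor hAB)) = 0 := by
    have h1 : Module.length R (LinearMap.ker (Submodule.factor hAB)) +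
        Module.length R (R ⧸ B) = 0 + Module.length R (R ⧸ B) := by rw [← hex, zero_add]
    exact WithTop.add_right_cancel hfin h1
  rw [Module.length_eq_zero_iff, Submodule.subsingleton_iff_eq_bot] at h0
  simp only [Submodule.factor, Submodule.ker_mapQ, Submodule.comap_id] at h0
  refine le_antisymm hAB ?_
  rw [← Submodule.ker_mkQ A, LinearMap.le_ker_iff_map]
  exact h0

/-- The length of `R ⧸ (x)` is the multiplicity when `x` generates a reduction of the maximal
ideal. -/
lemma length_quotient_span_eq_of_hasMultiplicity [IsLocalRing R] [IsNoetherianRing R]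
    [Ring.KrullDimLE 1 R] {e : ℕ} (he : HasMultiplicity R e) {x : R} (hxm : x ∈ maximalIdeal R)
    (hx : x ∈ nonZeroDivisors R)
    (hred : ∃ N : ℕ, ∀ n ≥ N,
      Ideal.span {x} * (maximalIdeal R) ^ n = (maximalIdeal R) ^ (n + 1)) :
    Module.length R (R ⧸ Ideal.span {x}) = e := by
  obtain ⟨N, hN⟩ := he
  obtain ⟨N', hN'⟩ := hred
  have h := hN (max N N') (le_max_left _ _)
  rw [← hN' (max N N') (le_max_right _ _), rlength_eq_coe_length, rlength_eq_coe_length,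
    length_quotient_span_mul hx] at h
  have hfin := length_quotient_ne_top_of_mem_nonZeroDivisors
    (Ideal.pow_mem_pow hxm (max N N')) (pow_mem hx (max N N'))
  exact WithTop.add_left_cancel hfin (by exact_mod_cast h)

/-- An Ulrich ideal `J` satisfies `x J = m J`. -/
lemma span_mul_eq_maximalIdeal_mul [IsLocalRing R] [IsNoetherianRing R] [Ring.KrullDimLE 1 R]
    {x : R} (hxm : x ∈ maximalIdeal R) (hx : x ∈ nonZeroDivisors R) {J : Ideal R}
    (hJ : ∃ y ∈ J, y ∈ nonZeroDivisors R)
    (hU : mu R J = (Module.length R (R ⧸ Ideal.span {x}) : WithBot ℕ∞)) :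
    Ideal.span {x} * J = maximalIdeal R * J := by
  obtain ⟨y, hyJ, hy⟩ := hJ
  refine eq_of_le_of_length_quotient_eq
    (Ideal.mul_mono_left ((Ideal.span_singleton_le_iff_mem _).mpr hxm)) ?_
    (length_quotient_ne_top_of_mem_nonZeroDivisors (Ideal.mul_mem_mul hxm hyJ) (mul_mem hx hy))
  rw [mu, rlength_eq_coe_length] at hU
  rw [length_quotient_span_mul hx, length_quotient_mul, WithBot.coe_injective hU, add_comm]

end Length

/-- The homology of a short complex of modules is isomorphic to `A`, embedded in `B` by `ι`, as soon
as a module `G` maps onto the cycles by `β` and onto the image of `ι` by `α`, and the kernel of `α`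
is the preimage of the boundaries under `β`. -/
lemma CategoryTheory.ShortComplex.nonempty_homology_linearEquiv {R : Type u} [CommRing R]
    (S : ShortComplex (ModuleCat.{u} R)) {A B G : Type*} [AddCommGroup A] [Module R A]
    [AddCommGroup B] [Module R B] [AddCommGroup G] [Module R G]
    (ι : A →ₗ[R] B) (α : G →ₗ[R] B) (β : G →ₗ[R] S.X₂)
    (hι : Function.Injective ι) (hα : LinearMap.range α = LinearMap.range ι)
    (hβ : ∀ g, S.g.hom (β g) = 0)
    (hsurj : ∀ z, S.g.hom z = 0 → ∃ g, β g = z)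
    (hker : ∀ g, α g = 0 ↔ ∃ y, S.f.hom y = β g) :
    Nonempty (S.homology ≃ₗ[R] A) := by
  let γ : G →ₗ[R] (LinearMap.ker S.g.hom ⧸ LinearMap.range S.moduleCatToCycles) :=
    (LinearMap.range S.moduleCatToCycles).mkQ ∘ₗ β.codRestrict (LinearMap.ker S.g.hom) hβ
  have hγ : Function.Surjective γ := by
    intro q
    obtain ⟨⟨z, hz⟩, rfl⟩ := Submodule.mkQ_surjective _ q
    obtain ⟨g, hg⟩ := hsurj z hz
    exact ⟨g, congrArg (Submodule.mkQ _) (Subtype.ext hg)⟩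
  have hγα : LinearMap.ker γ = LinearMap.ker α := by
    ext g
    rw [LinearMap.mem_ker, LinearMap.mem_ker, hker]
    refine (Submodule.Quotient.mk_eq_zero _).trans ⟨?_, ?_⟩
    · rintro ⟨y, hy⟩
      exact ⟨y, congrArg Subtype.val hy⟩
    · rintro ⟨y, hy⟩
      exact ⟨y, Subtype.ext hy⟩
  exact ⟨S.moduleCatHomologyIso.toLinearEquiv ≪≫ₗ (γ.quotKerEquivOfSurjective hγ).symm ≪≫ₗ
    Submodule.quotEquivOfEq _ _ hγα ≪≫ₗ α.quotKerEquivRange ≪≫ₗ LinearEquiv.ofEq _ _ hα ≪≫ₗ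
    (LinearEquiv.ofInjective ι hι).symm⟩

section Extension

variable {R : Type u} [CommRing R] {M N P Q : Type*} [AddCommGroup M] [Module R M]
  [AddCommGroup N] [Module R N] [AddCommGroup P] [Module R P] [AddCommGroup Q] [Module R Q]

lemma LinearMap.exists_comp_eq_of_exact {f : M →ₗ[R] N} {g : N →ₗ[R] P}
    (hfg : Function.Exact f g) (hg : Function.Surjective g) (φ : N →ₗ[R] Q)
    (hφ : φ ∘ₗ f = 0) : ∃ θ : P →ₗ[R] Q, θ ∘ₗ g = φ :=
  (exact_lcomp_of_exact_of_surjective Q hfg hg φ).mp hφ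

/-- Divide a linear form with values in `(x)` by the non-zero-divisor `x`. -/
lemma LinearMap.exists_mul_eq {x : R} (hx : x ∈ nonZeroDivisors R) (f : M →ₗ[R] R)
    (hf : ∀ p, f p ∈ Ideal.span {x}) : ∃ g : M →ₗ[R] R, ∀ p, x * g p = f p := by
  have hinj : Function.Injective (LinearMap.mulLeft R x) := fun a b hab =>
    (mul_cancel_left_mem_nonZeroDivisors hx).mp hab
  have hmem : ∀ p, f p ∈ LinearMap.range (LinearMap.mulLeft R x) := fun p => by
    obtain ⟨c, hc⟩ := Ideal.mem_span_singleton'.mp (hf p)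
    exact ⟨c, by rw [LinearMap.mulLeft_apply, mul_comm, hc]⟩
  let e := LinearEquiv.ofInjective (LinearMap.mulLeft R x) hinj
  refine ⟨e.symm.toLinearMap ∘ₗ f.codRestrict _ hmem, fun p => ?_⟩
  exact congrArg Subtype.val (e.apply_symm_apply (f.codRestrict _ hmem p))

/-- If `x I : m ⊆ (x)`, then every linear map from the first syzygy of the residue field to `I`
extends to a linear form on the ambient module. -/
lemma exists_extension_of_colon_le [IsLocalRing R] {x : R} (hxm : x ∈ maximalIdeal R)
    (hx : x ∈ nonZeroDivisors R) {I : Ideal R}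
    (hE : ∀ y : R, (∀ a ∈ maximalIdeal R, a * y ∈ Ideal.span {x} * I) → y ∈ Ideal.span {x})
    {d₂ : M →ₗ[R] N} {d₁ : N →ₗ[R] P} {π : P →ₗ[R] ResidueField R}
    (h₂ : Function.Exact d₂ d₁) (h₁ : Function.Exact d₁ π)
    (φ : N →ₗ[R] I) (hφ : φ ∘ₗ d₂ = 0) :
    ∃ g : P →ₗ[R] R, ∀ q, g (d₁ q) = φ q := by
  have hsmul : ∀ a ∈ maximalIdeal R, ∀ p, a • p ∈ LinearMap.range d₁ := fun a ha p => by
    refine (h₁ _).mp ?_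
    rw [map_smul, ← algebraMap_smul (ResidueField R) a, ResidueField.algebraMap_eq,
      (residue_eq_zero_iff a).mpr ha, zero_smul]
  have hex : Function.Exact d₂ d₁.rangeRestrict := fun q => by
    rw [← h₂ q, Subtype.ext_iff]
    rfl
  obtain ⟨ψ, hψ⟩ := LinearMap.exists_comp_eq_of_exact hex d₁.surjective_rangeRestrict φ hφ
  let f : P →ₗ[R] R := I.subtype ∘ₗ ψ ∘ₗ
    (LinearMap.lsmul R P x).codRestrict (LinearMap.range d₁) (hsmul x hxm)
  have hf : ∀ v : LinearMap.range d₁, f v = x * ψ v := fun v => by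
    have hv : (LinearMap.lsmul R P x).codRestrict (LinearMap.range d₁) (hsmul x hxm) v = x • v :=
      Subtype.ext rfl
    change (ψ ((LinearMap.lsmul R P x).codRestrict _ (hsmul x hxm) v) : R) = _
    rw [hv, map_smul]
    rfl
  obtain ⟨g, hg⟩ := LinearMap.exists_mul_eq hx f fun p => hE _ fun a ha => by
    rw [← smul_eq_mul a, ← map_smul, hf ⟨a • p, hsmul a ha p⟩]
    exact Ideal.mul_mem_mul (Ideal.mem_span_singleton_self x) (Subtype.property _)
  refine ⟨g, fun q => (mul_cancel_left_mem_nonZeroDivisors hx).mp ?_⟩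
  rw [hg, ← hψ]
  exact hf (d₁.rangeRestrict q)

/-- A linear form that agrees on the first syzygy of the residue field with a linear map to `I`
takes all its values in `I`. -/
lemma mem_of_eq_on_syzygy [IsLocalRing R] {x : R} (hxm : x ∈ maximalIdeal R)
    (hx : x ∈ nonZeroDivisors R) {I : Ideal R} {d₁ : N →ₗ[R] P} {π : P →ₗ[R] ResidueField R}
    (h₁ : Function.Exact d₁ π) (g : P →ₗ[R] R) (h : P →ₗ[R] I)
    (hgh : ∀ q, (h (d₁ q) : R) = g (d₁ q)) (p : P) : g p ∈ I := by
  obtain ⟨q, hq⟩ : x • p ∈ LinearMap.range d₁ := by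
    refine (h₁ _).mp ?_
    rw [map_smul, ← algebraMap_smul (ResidueField R) x, ResidueField.algebraMap_eq,
      (residue_eq_zero_iff x).mpr hxm, zero_smul]
  have hq' := hgh q
  rw [hq, map_smul, map_smul, Submodule.coe_smul, smul_eq_mul, smul_eq_mul] at hq'
  rw [← (mul_cancel_left_mem_nonZeroDivisors hx).mp hq']
  exact (h p).2

end Extension

/-- An ideal satisfying `x I : m ⊆ (x)` for a non-zero-divisor `x ∈ m` is Elias. -/
lemma eliasIdeal_of_colon_le {R : Type u} [CommRing R] [IsLocalRing R] {x : R}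
    (hxm : x ∈ maximalIdeal R) (hx : x ∈ nonZeroDivisors R) {I : Ideal R}
    (hE : ∀ y : R, (∀ a ∈ maximalIdeal R, a * y ∈ Ideal.span {x} * I) → y ∈ Ideal.span {x}) :
    EliasIdeal R I := by
  let Z : ModuleCat.{u} R := ModuleCat.of R (ResidueField R)
  let P := projectiveResolution Z
  let K := P.complex.linearYonedaObj R (ModuleCat.of R I)
  let d₂ := (P.complex.d 2 1).hom
  let d₁ := (P.complex.d 1 0).hom
  let e := (HomologicalComplex.singleObjXSelf (ComplexShape.down ℕ) 0 Z).toLinearEquiv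
  let π : P.complex.X 0 →ₗ[R] ResidueField R := e.toLinearMap ∘ₗ (P.π.f 0).hom
  have h₂ : Function.Exact d₂ d₁ :=
    (ShortComplex.ShortExact.moduleCat_exact_iff_function_exact _).mp (P.exact_succ 0)
  have h₁ : Function.Exact d₁ π := by
    have h := (ShortComplex.ShortExact.moduleCat_exact_iff_function_exact _).mp P.exact₀
    exact fun p => (e.map_eq_zero_iff).trans (h p)
  have hπ : Function.Surjective π :=
    e.surjective.comp ((ModuleCat.epi_iff_surjective (P.π.f 0)).mp inferInstance)
  have hproj : Module.Projective R (P.complex.X 0) :=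
    (P.complex.X 0).projective_of_module_projective
  let G : Submodule R (P.complex.X 0 →ₗ[R] R) :=
    { carrier := {g | ∀ q, g (d₁ q) ∈ I}
      add_mem' := fun ha hb q => I.add_mem (ha q) (hb q)
      zero_mem' := fun _ => I.zero_mem
      smul_mem' := fun c _ ha q => I.mul_mem_left c (ha q) }
  let α : G →ₗ[R] (P.complex.X 0 →ₗ[R] R ⧸ I) :=
    LinearMap.compRight R (Submodule.mkQ I) ∘ₗ G.subtype
  let β : G →ₗ[R] (K.sc' 0 1 2).X₂ :=
    { toFun := fun g => ModuleCat.ofHom ((g.1 ∘ₗ d₁).codRestrict I g.2)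
      map_add' := fun _ _ => rfl
      map_smul' := fun _ _ => rfl }
  have key : Nonempty ((K.sc' 0 1 2).homology ≃ₗ[R] (ResidueField R →ₗ[R] R ⧸ I)) := by
    refine ShortComplex.nonempty_homology_linearEquiv (G := G) _
      (LinearMap.lcomp R (R ⧸ I) π) α β
      (LinearMap.lcomp_injective_of_surjective π hπ) (le_antisymm ?_ ?_) ?_ ?_ ?_
    · rintro _ ⟨g, rfl⟩
      exact LinearMap.exists_comp_eq_of_exact h₁ hπ (α g) <| LinearMap.ext fun q =>
        (Submodule.Quotient.mk_eq_zero I).mpr (g.2 q)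
    · rintro _ ⟨θ, rfl⟩
      obtain ⟨g, hg⟩ := Module.projective_lifting_property (Submodule.mkQ I) (θ ∘ₗ π)
        (Submodule.mkQ_surjective I)
      refine ⟨⟨g, fun q => (Submodule.Quotient.mk_eq_zero I).mp ?_⟩, hg⟩
      refine (LinearMap.congr_fun hg (d₁ q)).trans ?_
      rw [LinearMap.comp_apply, h₁.apply_apply_eq_zero, map_zero]
    · intro g
      refine ModuleCat.hom_ext (LinearMap.ext fun q => Subtype.ext ?_)
      change g.1 (d₁ (d₂ q)) = 0
      rw [h₂.apply_apply_eq_zero, map_zero]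
    · intro z hz
      change P.complex.X 1 ⟶ ModuleCat.of R I at z
      obtain ⟨g, hg⟩ := exists_extension_of_colon_le hxm hx hE h₂ h₁ z.hom
        (congrArg ModuleCat.Hom.hom hz)
      refine ⟨⟨g, fun q => ?_⟩, ModuleCat.hom_ext (LinearMap.ext fun q => Subtype.ext (hg q))⟩
      rw [hg]
      exact (z.hom q).2
    · intro g
      constructor
      · intro hg
        have hmem : ∀ p, g.1 p ∈ I := fun p =>
          (Submodule.Quotient.mk_eq_zero I).mp (LinearMap.congr_fun hg p)
        exact ⟨ModuleCat.ofHom (g.1.codRestrict I hmem), rfl⟩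
      · rintro ⟨h, hh⟩
        change P.complex.X 0 ⟶ ModuleCat.of R I at h
        refine LinearMap.ext fun p => (Submodule.Quotient.mk_eq_zero I).mpr
          (mem_of_eq_on_syzygy hxm hx h₁ g.1 h.hom (fun q => ?_) p)
        exact congrArg (fun f : P.complex.X 1 ⟶ ModuleCat.of R I => (f.hom q : R)) hh
  obtain ⟨E⟩ := key
  exact rlength_eq_of_linearEquiv
    ((P.isoExt 1 (ModuleCat.of R I) ≪≫
      K.homologyIsoSc' 0 1 2 (by simp) (by simp)).toLinearEquiv ≪≫ₗ E)

theorem elias_of_ulrich_generators (R : Type u) [CommRing R] [IsLocalRing R] [IsNoetherianRing R]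
    (hdim : ringKrullDim R = 1)
    (hCM : ∃ x ∈ maximalIdeal R, x ∈ nonZeroDivisors R)
    (e : ℕ) (he : HasMultiplicity R e)
    (x : R) (hxm : x ∈ maximalIdeal R) (hx : x ∈ nonZeroDivisors R)
    (hred : ∃ N : ℕ, ∀ n ≥ N,
      Ideal.span {x} * (maximalIdeal R) ^ n = (maximalIdeal R) ^ (n + 1))
    (I J : Ideal R) (hIJ : I ≤ J)
    (hI : IsMPrimary R I) (hJ : IsMPrimary R J)
    (hIreg : ∃ y ∈ I, y ∈ nonZeroDivisors R) (hJreg : ∃ y ∈ J, y ∈ nonZeroDivisors R)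
    (hU : mu R J = (e : WithBot ℕ∞))
    (hgen : ∀ y ∈ J, y ∉ maximalIdeal R * J →
      ¬ (maximalIdeal R * Ideal.span {y} ≤ Ideal.span {x} * I)) :
    EliasIdeal R I := by 
  have hdimLE : Ring.KrullDimLE 1 R := (Order.krullDimLE_iff _ _).mpr hdim.le
  have hxJ := span_mul_eq_maximalIdeal_mul hxm hx hJreg
    (by rw [hU, length_quotient_span_eq_of_hasMultiplicity he hxm hx hred, WithBot.coe_natCast])
  refine eliasIdeal_of_colon_le hxm hx fun y hy => ?_
  have hyI : y ∈ I := by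
    obtain ⟨c, hc, hcy⟩ := Ideal.mem_span_singleton_mul.mp (hy x hxm)
    rwa [← (mul_cancel_left_mem_nonZeroDivisors hx).mp hcy]
  have hymJ : y ∈ maximalIdeal R * J := by
    by_contra hyJ
    refine hgen y (hIJ hyI) hyJ (Ideal.mul_le.mpr fun a ha b hb => ?_)
    obtain ⟨c, rfl⟩ := Ideal.mem_span_singleton'.mp hb
    rw [mul_left_comm]
    exact Ideal.mul_mem_left _ c (hy a ha)
  rw [← hxJ] at hymJ
  exact Ideal.mul_le_left hymJ
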